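/- (Theorem 1) Let A be a random M×N matrix over F_q whose M·N entries are i.i.d. with distribution μ, where M ≥ N ≥ 1. Then the expected number of nonzero vectors x ∈ F_q^N with Ax = 0 equals Σ_{w=1}^{N} C(N,w)·(q−1)^w·γ_w^M; equivalently, this expectation divided by (q−1) equals μ0(N,M) = (1/(q−1))·Σ_{w=1}^{N} C(N,w)·(q−1)^w·γ_w^M. -/

import Mathlib

open Finset
open scoped Classical

noncomputable section

/-- The entry distribution μ on the finite field `F`: the value `0` has
probability `ε_SR` and each nonzero value has probability `(1-ε_SR)/(q-1)`,
where `q = |F|`. -/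
def muDist (F : Type*) [Field F] [Fintype F] [DecidableEq F] (εSR : ℝ) (t : F) : ℝ :=
  if t = 0 then εSR else (1 - εSR) / ((Fintype.card F : ℝ) - 1)

/-- The probability that a random `M × N` matrix over `F` with i.i.d.
`μ`-distributed entries equals the fixed matrix `A`. -/
def matProb (F : Type*) [Field F] [Fintype F] [DecidableEq F] (εSR : ℝ) {M N : ℕ}
    (A : Matrix (Fin M) (Fin N) F) : ℝ :=
  ∏ i, ∏ j, muDist F εSR (A i j)

/-- `γ_w = q⁻¹ + (1 - q⁻¹)·(1 - (1-ε_SR)/(1-q⁻¹))^w`. -/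
def gammaW (q εSR : ℝ) (w : ℕ) : ℝ :=
  q⁻¹ + (1 - q⁻¹) * (1 - (1 - εSR) / (1 - q⁻¹)) ^ w

/-- `μ0(N,M) = (1/(q-1))·Σ_{w=1}^{N} C(N,w)·(q-1)^w·γ_w^M`. -/
def mu0 (q εSR : ℝ) (N M : ℕ) : ℝ :=
  (1 / (q - 1)) * ∑ w ∈ Icc 1 N, (N.choose w : ℝ) * (q - 1) ^ w * gammaW q εSR w ^ M

/-- The entry distribution is a mixture of the uniform distribution and the point mass at `0`. -/
theorem muDist_eq_mixture (F : Type*) [Field F] [Fintype F] [DecidableEq F] (εSR : ℝ) (t : F) :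
    muDist F εSR t =
      (1 - (1 - (1 - εSR) / (1 - (Fintype.card F : ℝ)⁻¹))) / (Fintype.card F : ℝ) +
        (1 - (1 - εSR) / (1 - (Fintype.card F : ℝ)⁻¹)) * (if t = 0 then 1 else 0) := by
  have hq : (1 : ℝ) < Fintype.card F := by exact_mod_cast Fintype.one_lt_card
  have h0 : (Fintype.card F : ℝ) ≠ 0 := by positivity
  have h1 : (Fintype.card F : ℝ) - 1 ≠ 0 := by linarith
  have h2 : 1 - (Fintype.card F : ℝ)⁻¹ = ((Fintype.card F : ℝ) - 1) / Fintype.card F := by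
    field_simp
  rw [muDist, h2]
  split_ifs <;> field_simp <;> ring

theorem sum_muDist (F : Type*) [Field F] [Fintype F] [DecidableEq F] (εSR : ℝ) :
    ∑ t : F, muDist F εSR t = 1 := by
  have h0 : (Fintype.card F : ℝ) ≠ 0 := by exact_mod_cast Fintype.card_ne_zero
  simp_rw [muDist_eq_mixture, Finset.sum_add_distrib, ← Finset.mul_sum]
  simp only [sum_const, card_univ, nsmul_eq_mul, sum_ite_eq', mem_univ, if_true]
  field_simp
  ring

/-- The law of the inner product of a fixed vector with a random row. -/
theorem sum_prod_muDist_dotProduct_eq (F : Type*) [Field F] [Fintype F] [DecidableEq F]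
    (εSR : ℝ) {n : ℕ} (x : Fin n → F) (t : F) :
    (∑ a : Fin n → F, (∏ j, muDist F εSR (a j)) * (if a ⬝ᵥ x = t then 1 else 0)) =
      (1 - ∏ j, (if x j = 0 then 1 else 1 - (1 - εSR) / (1 - (Fintype.card F : ℝ)⁻¹))) /
          (Fintype.card F : ℝ) +
        (∏ j, (if x j = 0 then 1 else 1 - (1 - εSR) / (1 - (Fintype.card F : ℝ)⁻¹))) *
          (if t = 0 then 1 else 0) := by
  induction n generalizing t with
  | zero => simp [dotProduct, eq_comm]
  | succ n ih =>
    have hstep : (∑ a : Fin (n + 1) → F,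
        (∏ j, muDist F εSR (a j)) * (if a ⬝ᵥ x = t then (1 : ℝ) else 0)) =
        ∑ b : F, muDist F εSR b * ∑ a : Fin n → F, (∏ j, muDist F εSR (a j)) *
          (if a ⬝ᵥ (fun j => x j.succ) = t - b * x 0 then 1 else 0) := by
      rw [← (Fin.consEquiv fun _ => F).sum_comp, Fintype.sum_prod_type]
      refine Finset.sum_congr rfl fun b _ => ?_
      rw [Finset.mul_sum]
      refine Finset.sum_congr rfl fun a _ => ?_
      simp only [Fin.consEquiv_apply, Fin.prod_univ_succ, Fin.cons_zero, Fin.cons_succ,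
        dotProduct, Fin.sum_univ_succ, eq_sub_iff_add_eq', mul_assoc]
    rw [hstep]
    simp_rw [ih, mul_add, Finset.sum_add_distrib, ← Finset.sum_mul, sum_muDist,
      Fin.prod_univ_succ]
    set c := 1 - (1 - εSR) / (1 - (Fintype.card F : ℝ)⁻¹) with hc
    set p := ∏ j : Fin n, (if x j.succ = 0 then 1 else c)
    have hpull : ∀ b : F, muDist F εSR b * (p * (if t - b * x 0 = 0 then 1 else 0)) =
        p * (muDist F εSR b * (if t - b * x 0 = 0 then 1 else 0)) := fun b => by ring
    simp_rw [hpull, ← Finset.mul_sum]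
    by_cases hx : x 0 = 0
    · simp [hx, sum_muDist]
    · have hb : ∀ b : F, t - b * x 0 = 0 ↔ b = t / x 0 := fun b => by
        rw [sub_eq_zero, eq_div_iff hx, eq_comm]
      simp only [hb, mul_ite, mul_one, mul_zero, sum_ite_eq', mem_univ, if_true, hx, if_false]
      rw [muDist_eq_mixture, ← hc]
      simp only [div_eq_zero_iff, hx, or_false]
      split_ifs <;> ring

theorem sum_prod_muDist_dotProduct_eq_zero (F : Type*) [Field F] [Fintype F] [DecidableEq F]
    (εSR : ℝ) {n : ℕ} (x : Fin n → F) :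
    (∑ a : Fin n → F, (∏ j, muDist F εSR (a j)) * (if a ⬝ᵥ x = 0 then 1 else 0)) =
      gammaW (Fintype.card F : ℝ) εSR (hammingNorm x) := by
  rw [sum_prod_muDist_dotProduct_eq, gammaW, Finset.prod_ite, hammingNorm]
  simp only [prod_const_one, prod_const, one_mul, if_true, mul_one, ne_eq]
  ring

theorem sum_matProb_mulVec_eq_zero (F : Type*) [Field F] [Fintype F] [DecidableEq F]
    (εSR : ℝ) {M N : ℕ} (x : Fin N → F) :
    (∑ A : Matrix (Fin M) (Fin N) F, matProb F εSR A * (if A.mulVec x = 0 then 1 else 0)) =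
      gammaW (Fintype.card F : ℝ) εSR (hammingNorm x) ^ M := by
  have hprod := Finset.prod_univ_sum (fun _ : Fin M => (univ : Finset (Fin N → F)))
    (fun _ a => (∏ j, muDist F εSR (a j)) * (if a ⬝ᵥ x = 0 then (1 : ℝ) else 0))
  simp only [sum_prod_muDist_dotProduct_eq_zero, prod_const, card_univ, Fintype.card_fin,
    Fintype.piFinset_univ] at hprod
  rw [hprod]
  refine Finset.sum_congr rfl fun A _ => ?_
  rw [Finset.prod_mul_distrib, matProb, Finset.prod_boole]
  simp [funext_iff, Matrix.mulVec]

theorem card_filter_support_eq {ι F : Type*} [Fintype ι] [DecidableEq ι] [Fintype F]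
    [DecidableEq F] [Zero F] (s : Finset ι) :
    (univ.filter fun x : ι → F => (univ.filter fun i => x i ≠ 0) = s).card =
      (Fintype.card F - 1) ^ s.card := by
  have hpi : (univ.filter fun x : ι → F => (univ.filter fun i => x i ≠ 0) = s) =
      Fintype.piFinset fun i => if i ∈ s then univ.erase 0 else {0} := by
    ext x
    simp only [mem_filter, mem_univ, true_and, Fintype.mem_piFinset, Finset.ext_iff]
    refine forall_congr' fun i => ?_
    by_cases hi : i ∈ s <;> simp [hi]
  rw [hpi, Fintype.card_piFinset]
  simp only [apply_ite Finset.card, card_singleton, card_erase_of_mem (mem_univ _), card_univ]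
  simp

theorem sum_hammingNorm {ι F : Type*} [Fintype ι] [DecidableEq ι] [Fintype F] [DecidableEq F] [Zero F]
    (g : ℕ → ℝ) :
    ∑ x : ι → F, g (hammingNorm x) =
      ∑ w ∈ range (Fintype.card ι + 1),
        ((Fintype.card ι).choose w : ℝ) * ((Fintype.card F : ℝ) - 1) ^ w * g w := by
  have hF : 1 ≤ Fintype.card F := Fintype.card_pos_iff.mpr ⟨0⟩
  have hfib := Finset.sum_fiberwise_of_maps_to
    (s := (univ : Finset (ι → F))) (t := (univ : Finset ι).powerset)
    (g := fun x => univ.filter fun i => x i ≠ 0) (fun _ _ => by simp)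
    (fun x => g (hammingNorm x))
  rw [← hfib]
  have hconst : ∀ s : Finset ι,
      (∑ x : ι → F with (univ.filter fun i => x i ≠ 0) = s, g (hammingNorm x)) =
        ((Fintype.card F : ℝ) - 1) ^ s.card * g s.card := fun s => by
    rw [Finset.sum_congr rfl fun x hx => by
      rw [hammingNorm, (mem_filter.mp hx).2], sum_const, card_filter_support_eq, nsmul_eq_mul]
    push_cast [Nat.cast_sub hF]
    rfl
  rw [Finset.sum_congr rfl fun s _ => hconst s,
    Finset.sum_powerset_apply_card (fun w => ((Fintype.card F : ℝ) - 1) ^ w * g w)]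
  simp [mul_assoc]

theorem expected_card_nonzero_kernel (F : Type*) [Field F] [Fintype F] [DecidableEq F]
    (εSR : ℝ) (M N : ℕ) :
    (∑ A : Matrix (Fin M) (Fin N) F,
        matProb F εSR A *
          ((univ.filter fun x : Fin N → F => x ≠ 0 ∧ A.mulVec x = 0).card : ℝ)) =
      ∑ w ∈ Icc 1 N, (N.choose w : ℝ) * ((Fintype.card F : ℝ) - 1) ^ w *
          gammaW (Fintype.card F : ℝ) εSR w ^ M := by
  have hswap : (∑ A : Matrix (Fin M) (Fin N) F,
        matProb F εSR A *
          ((univ.filter fun x : Fin N → F => x ≠ 0 ∧ A.mulVec x = 0).card : ℝ)) =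
      ∑ x : Fin N → F, if hammingNorm x = 0 then 0 else
        gammaW (Fintype.card F : ℝ) εSR (hammingNorm x) ^ M := by
    simp_rw [Finset.card_filter, Nat.cast_sum, Finset.mul_sum]
    rw [Finset.sum_comm]
    refine Finset.sum_congr rfl fun x _ => ?_
    rw [← sum_matProb_mulVec_eq_zero]
    by_cases hx : x = 0 <;> simp [hx]
  rw [hswap, sum_hammingNorm (fun w => if w = 0 then 0 else
    gammaW (Fintype.card F : ℝ) εSR w ^ M), Fintype.card_fin]
  refine (Finset.sum_subset_zero_on_sdiff (fun w hw => ?_) (fun w hw => ?_) fun w hw => ?_).symm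
  · simp only [mem_Icc, mem_range] at hw ⊢
    omega
  · have hw0 : w = 0 := by
      simp only [mem_sdiff, mem_Icc, mem_range] at hw
      omega
    simp [hw0]
  · have hw0 : w ≠ 0 := by
      simp only [mem_Icc] at hw
      omega
    simp [hw0]

/-- Theorem 1: for a random `M × N` matrix `A` over `F_q` with i.i.d.
`μ`-distributed entries and `M ≥ N ≥ 1`, the expected number of nonzero vectors
`x ∈ F_q^N` with `Ax = 0` equals `Σ_{w=1}^{N} C(N,w)·(q-1)^w·γ_w^M`; equivalently,
this expectation divided by `q-1` equals `μ0(N,M)`. -/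
theorem stmt_5 (F : Type*) [Field F] [Fintype F] [DecidableEq F]
    (hq : 2 ≤ Fintype.card F)
    (εSR : ℝ) (hεSR : εSR ∈ Set.Icc (0 : ℝ) 1)
    (M N : ℕ) (hN : 1 ≤ N) (hMN : N ≤ M) :
    (∑ A : Matrix (Fin M) (Fin N) F,
        matProb F εSR A *
          ((univ.filter fun x : Fin N → F => x ≠ 0 ∧ A.mulVec x = 0).card : ℝ)) =
      (∑ w ∈ Icc 1 N, (N.choose w : ℝ) * ((Fintype.card F : ℝ) - 1) ^ w *
          gammaW (Fintype.card F : ℝ) εSR w ^ M) ∧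
    (∑ A : Matrix (Fin M) (Fin N) F,
        matProb F εSR A *
          ((univ.filter fun x : Fin N → F => x ≠ 0 ∧ A.mulVec x = 0).card : ℝ)) /
        ((Fintype.card F : ℝ) - 1) =
      mu0 (Fintype.card F : ℝ) εSR N M := by
  refine ⟨expected_card_nonzero_kernel F εSR M N, ?_⟩
  rw [expected_card_nonzero_kernel, mu0, div_eq_inv_mul, one_div]
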